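/- Let a₁, a₂, b₁, b₂ be nonnegative real numbers with a₁² + a₂² + b₁² + b₂² = 1/4. Then √((a₁² − a₂²)² + 4b₁²(a₁+a₂)²) + √((a₁² − a₂²)² + 4b₂²(a₁+a₂)²) ≤ 1/2. -/

import Mathlib

theorem stmt_9 (a₁ a₂ b₁ b₂ : ℝ) (ha₁ : 0 ≤ a₁) (ha₂ : 0 ≤ a₂) (hb₁ : 0 ≤ b₁) (hb₂ : 0 ≤ b₂)
    (hnorm : a₁ ^ 2 + a₂ ^ 2 + b₁ ^ 2 + b₂ ^ 2 = 1 / 4) :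
    Real.sqrt ((a₁ ^ 2 - a₂ ^ 2) ^ 2 + 4 * b₁ ^ 2 * (a₁ + a₂) ^ 2) +
      Real.sqrt ((a₁ ^ 2 - a₂ ^ 2) ^ 2 + 4 * b₂ ^ 2 * (a₁ + a₂) ^ 2) ≤ 1 / 2 := by
  have hx := Real.sq_sqrt (x := (a₁ ^ 2 - a₂ ^ 2) ^ 2 + 4 * b₁ ^ 2 * (a₁ + a₂) ^ 2) (by positivity)
  have hy := Real.sq_sqrt (x := (a₁ ^ 2 - a₂ ^ 2) ^ 2 + 4 * b₂ ^ 2 * (a₁ + a₂) ^ 2) (by positivity)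
  set x := Real.sqrt ((a₁ ^ 2 - a₂ ^ 2) ^ 2 + 4 * b₁ ^ 2 * (a₁ + a₂) ^ 2)
  set y := Real.sqrt ((a₁ ^ 2 - a₂ ^ 2) ^ 2 + 4 * b₂ ^ 2 * (a₁ + a₂) ^ 2)
  have hsum : x ^ 2 + y ^ 2 = (a₁ + a₂) ^ 2 * (1 - 2 * (a₁ + a₂) ^ 2) := by
    linear_combination hx + hy + 4 * (a₁ + a₂) ^ 2 * hnorm
  refine abs_le_of_sq_le_sq' (b := 1 / 2) ?_ (by norm_num) |>.2
  linarith [sq_nonneg (x - y), sq_nonneg (4 * (a₁ + a₂) ^ 2 - 1)]
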